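/- Assume (a) (n+θ_i)(nσ² − δ_iα) − nθ_iδ_iσ² ≠ 0 for all i, (b) nσ² − 2δ_iα > 0 for all i, and (c) 1 − Σ_{j=1}^n [(n−θ_j)αδ_j − nθ_j(δ_j−1)σ²]/[(n+θ_j)(nσ² − αδ_j) − nθ_jδ_jσ²] ≠ 0. Then the CRRA best-response system has exactly one solution π ∈ ℝⁿ, given componentwise by π_i = n²δ_iμ/[(n+θ_i)(nσ² − δ_iα) − nθ_iδ_iσ²] + ([(n−θ_i)αδ_i − nθ_i(δ_i−1)σ²]/[(n+θ_i)(nσ² − δ_iα) − nθ_iδ_iσ²])·(1 − Σ_{j=1}^n [(n−θ_j)αδ_j − nθ_j(δ_j−1)σ²]/[(n+θ_j)(nσ² − αδ_j) − nθ_jδ_jσ²])^{−1}·Σ_{j=1}^n n²δ_jμ/[(n+θ_j)(nσ² − δ_jα) − nθ_jδ_jσ²]. -/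

import Mathlib

open Finset

/-- An affine system in which each unknown depends on the others only through their total
has exactly one solution when the coefficients of the total do not sum to `1`. -/
theorem forall_eq_add_mul_sum_iff {ι K : Type*} [Fintype ι] [Field K] (a b x : ι → K)
    (hb : 1 - ∑ j, b j ≠ 0) :
    (∀ i, x i = a i + b i * ∑ j, x j) ↔
      x = fun i => a i + b i * (1 - ∑ j, b j)⁻¹ * ∑ j, a j := by
  have total_iff (s : K) : s = ∑ j, a j + (∑ j, b j) * s ↔
      s = (1 - ∑ j, b j)⁻¹ * ∑ j, a j := by
    rw [eq_inv_mul_iff_mul_eq₀ hb, sub_mul, one_mul, sub_eq_iff_eq_add]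
  constructor
  · intro h
    have hsum : ∑ j, x j = ∑ j, a j + (∑ j, b j) * ∑ j, x j := by
      rw [Finset.sum_mul, ← Finset.sum_add_distrib]
      exact Finset.sum_congr rfl fun i _ => h i
    funext i
    rw [mul_assoc, ← (total_iff _).1 hsum]
    exact h i
  · rintro h i
    have hsum : ∑ j, x j = (1 - ∑ j, b j)⁻¹ * ∑ j, a j := by
      rw [h]
      simp only [mul_assoc]
      rw [Finset.sum_add_distrib, ← Finset.sum_mul]
      exact ((total_iff _).2 rfl).symm
    rw [hsum, ← mul_assoc]
    exact congrFun h i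

/-- Unique constant Nash equilibrium of the CRRA relative-performance game with linear
price impact: under conditions (a), (b), (c), the CRRA best-response system has exactly
one solution, given by the stated formula. -/
theorem crra_unique_nash
    (n : ℕ) (hn : 1 ≤ n) (μ σ α : ℝ) (hμ : 0 < μ) (hσ : 0 < σ)
    (δ θ : Fin n → ℝ) (hδ : ∀ i, 0 < δ i) (hθ : ∀ i, 0 ≤ θ i ∧ θ i ≤ 1)
    (ha : ∀ i, ((n : ℝ) + θ i) * ((n : ℝ) * σ ^ 2 - δ i * α) - (n : ℝ) * θ i * δ i * σ ^ 2 ≠ 0)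
    (hb : ∀ i, 0 < (n : ℝ) * σ ^ 2 - 2 * δ i * α)
    (hc : 1 - ∑ j, (((n : ℝ) - θ j) * α * δ j - (n : ℝ) * θ j * (δ j - 1) * σ ^ 2) /
        (((n : ℝ) + θ j) * ((n : ℝ) * σ ^ 2 - α * δ j) - (n : ℝ) * θ j * δ j * σ ^ 2) ≠ 0) :
    ∀ π : Fin n → ℝ,
      (∀ i, ((n : ℝ) * σ ^ 2 - 2 * α * δ i) * π i =
          (n : ℝ) * δ i * μ +
            (α * δ i * (1 - θ i / (n : ℝ)) - σ ^ 2 * θ i * (δ i - 1)) *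
              ∑ j ∈ Finset.univ.erase i, π j)
        ↔ π = fun i =>
            (n : ℝ) ^ 2 * δ i * μ /
                (((n : ℝ) + θ i) * ((n : ℝ) * σ ^ 2 - δ i * α) - (n : ℝ) * θ i * δ i * σ ^ 2) +
              ((((n : ℝ) - θ i) * α * δ i - (n : ℝ) * θ i * (δ i - 1) * σ ^ 2) /
                  (((n : ℝ) + θ i) * ((n : ℝ) * σ ^ 2 - δ i * α) -
                    (n : ℝ) * θ i * δ i * σ ^ 2)) *
                (1 - ∑ j, (((n : ℝ) - θ j) * α * δ j - (n : ℝ) * θ j * (δ j - 1) * σ ^ 2) /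
                    (((n : ℝ) + θ j) * ((n : ℝ) * σ ^ 2 - α * δ j) -
                      (n : ℝ) * θ j * δ j * σ ^ 2))⁻¹ *
                ∑ j, (n : ℝ) ^ 2 * δ j * μ /
                  (((n : ℝ) + θ j) * ((n : ℝ) * σ ^ 2 - δ j * α) -
                    (n : ℝ) * θ j * δ j * σ ^ 2) := by
  intro π
  have hn0 : (n : ℝ) ≠ 0 := Nat.cast_ne_zero.2 (by omega)
  simp only [mul_comm (δ _) α] at ha ⊢
  rw [← forall_eq_add_mul_sum_iff _ _ π hc]
  refine forall_congr' fun i => ?_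
  rw [Finset.sum_erase_eq_sub (Finset.mem_univ i), div_mul_eq_mul_div, ← add_div,
    eq_div_iff (ha i), ← mul_right_inj' hn0]
  generalize ∑ j, π j = S
  have hθ' : (n : ℝ) * (1 - θ i / n) = n - θ i := by field_simp
  constructor <;> intro h
  · linear_combination h + α * δ i * (S - π i) * hθ'
  · linear_combination h - α * δ i * (S - π i) * hθ'
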